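/- Let G=(N,E) be a DAG, let G'=(N,E') be a DAG that satisfies Goal I for G, and let O' be a topological ordering of G'. Then the graph G̃'=(N, E' ∪ E_leaves), where E_leaves={(s,t): s,t ∈ leaves(G), O'(s)<O'(t)}, is a DAG that satisfies Goal II for G. -/

import Mathlib

open Finset

/-! Basic graph-theoretic definitions for Bayesian networks. -/

/-- Two nodes are joined (adjacent) in the directed graph `E`. -/
def GJoined {V : Type*} (E : V → V → Prop) (a b : V) : Prop := E a b ∨ E b a

/-- A directed graph (given by its edge relation) is a DAG iff it has no cycles:
no node can reach itself by a nonempty directed walk. -/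
def IsDAG {V : Type*} (E : V → V → Prop) : Prop := ∀ s, ¬ Relation.TransGen E s s

/-- The set of parents of `s`. -/
def paG {V : Type*} (E : V → V → Prop) (s : V) : Set V := {t | E t s}

/-- The set of children of `s`. -/
def chG {V : Type*} (E : V → V → Prop) (s : V) : Set V := {t | E s t}

/-- The set of descendants of `s` (nodes reachable from `s` by a nonempty directed path). -/
def desG {V : Type*} (E : V → V → Prop) (s : V) : Set V := {t | Relation.TransGen E s t}

/-- A set of nodes is complete if all pairs of distinct elements are joined. -/
def GComplete {V : Type*} (E : V → V → Prop) (S : Set V) : Prop :=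
  ∀ a ∈ S, ∀ b ∈ S, a ≠ b → GJoined E a b

/-- A directed graph is perfect if the parent set of every node is complete. -/
def GPerfect {V : Type*} (E : V → V → Prop) : Prop := ∀ s, GComplete E (paG E s)

/-- `a` and `b` are joined in the moral graph `G^M` of `E`:
either joined in `E` or distinct common parents of some node. -/
def MoralEdge {V : Type*} (E : V → V → Prop) (a b : V) : Prop :=
  E a b ∨ E b a ∨ (a ≠ b ∧ ∃ s, E a s ∧ E b s)

/-- A topological ordering of a graph on a finite node set: an injective map into
`{1, …, |N|}` (encoded as `Fin (card V)`) increasing along edges. -/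
def IsTopo {V : Type*} [Fintype V] (E : V → V → Prop) (O : V → Fin (Fintype.card V)) : Prop :=
  Function.Injective O ∧ ∀ s t, E s t → O s < O t

/-! d-separation. -/

/-- `u` is a v-structure (collider) of the trail `l` in the graph `E`. -/
def VStruct {V : Type*} (E : V → V → Prop) (l : List V) (u : V) : Prop :=
  ∃ l₁ l₂ a b, l = l₁ ++ a :: u :: b :: l₂ ∧ E a u ∧ E b u

/-- `l` is a trail in the graph `E`: a nonempty sequence of distinct nodes consecutively joined. -/
def IsTrail {V : Type*} (E : V → V → Prop) (l : List V) : Prop :=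
  l ≠ [] ∧ l.Nodup ∧ l.Chain' (GJoined E)

/-- The trail `l` is blocked by `S`. -/
def BlockedBy {V : Type*} (E : V → V → Prop) (S : Set V) (l : List V) : Prop :=
  ∃ u ∈ l, (u ∈ S ∧ ¬ VStruct E l u) ∨
    (VStruct E l u ∧ u ∉ S ∧ ∀ t ∈ desG E u, t ∉ S)

/-- d-separation: every trail from a node of `A` to a node of `B` is blocked by `S`. -/
def DSep {V : Type*} (E : V → V → Prop) (A B S : Set V) : Prop :=
  ∀ (l : List V) (a b : V), IsTrail E l → l.head? = some a → l.getLast? = some b →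
    a ∈ A → b ∈ B → BlockedBy E S l

/-- The set of leaves (childless nodes), as a `Finset`. -/
def leavesF {V : Type*} [Fintype V] (E : V → V → Prop) [DecidableRel E] : Finset V :=
  Finset.univ.filter fun s => ∀ t, ¬ E s t

/-! Probability on graphs (finite state spaces, pmfs). -/

section Prob

variable {V : Type*} [Fintype V] [DecidableEq V]
variable (X : V → Type*) [∀ v, Fintype (X v)]

/-- `p` is a probability mass function on `X_N = ∏ v, X v`. -/
def IsPMF (p : (∀ v, X v) → ℝ) : Prop :=
  (∀ x, 0 ≤ p x) ∧ ∑ x, p x = 1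

/-- `k` is a kernel function for the node `s` w.r.t. the graph `E`: it is nonnegative,
depends on the configuration only through the parents of `s` in `E`, and is normalized. -/
def IsKernel (E : V → V → Prop) (s : V) (k : X s → (∀ v, X v) → ℝ) : Prop :=
  (∀ a x, 0 ≤ k a x) ∧
  (∀ a x y, (∀ t, E t s → x t = y t) → k a x = k a y) ∧
  (∀ x, ∑ a, k a x = 1)

/-- `p` factorizes over the graph `E`: it is a product of kernel functions, one per node. -/
def Factorizes (E : V → V → Prop) (p : (∀ v, X v) → ℝ) : Prop :=
  ∃ k : ∀ s, X s → (∀ v, X v) → ℝ,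
    (∀ s, IsKernel X E s (k s)) ∧ ∀ x, p x = ∏ s, k s (x s) x

variable [∀ v, DecidableEq (X v)]

/-- The marginal of `p` on the coordinates in `C`, evaluated at (the `C`-part of) `x`. -/
def marg (p : (∀ v, X v) → ℝ) (C : Finset V) (x : ∀ v, X v) : ℝ :=
  ∑ y, if ∀ v ∈ C, y v = x v then p y else 0

/-- Conditional independence `A ⟂⟂ B ∣ S` w.r.t. the pmf `p`. -/
def CondIndep (p : (∀ v, X v) → ℝ) (A B S : Finset V) : Prop :=
  ∀ x, 0 < marg X p S x →
    marg X p (A ∪ B ∪ S) x * marg X p S x = marg X p (A ∪ S) x * marg X p (B ∪ S) x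

/-- `q` is a conditional system for `N ∖ A` given `A`: a family of pmfs on `X_{N∖A}`,
one for every configuration on `A`.  Here `q x` encodes `q(x_{N∖A} ∣ x_A)`. -/
def IsCondSystem (A : Finset V) (q : (∀ v, X v) → ℝ) : Prop :=
  (∀ x, 0 ≤ q x) ∧ ∀ x : ∀ v, X v, (∑ y, if ∀ v ∈ A, y v = x v then q y else 0) = 1

/-- The conditional system `q` for `N ∖ A` given `A` factorizes over the graph `E`. -/
def CondFactorizes (E : V → V → Prop) (A : Finset V) (q : (∀ v, X v) → ℝ) : Prop :=
  ∃ k : ∀ s, X s → (∀ v, X v) → ℝ,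
    (∀ s ∉ A, IsKernel X E s (k s)) ∧ ∀ x, q x = ∏ s ∈ Finset.univ \ A, k s (x s) x

/-- The conditional system `q` for `N ∖ A` given `A` is a version of the conditional
distribution of the pmf `p`. -/
def IsVersionOf (A : Finset V) (q p : (∀ v, X v) → ℝ) : Prop :=
  ∀ x, p x = q x * marg X p A x

/-- `G'` (edges `E'`) satisfies Goal I for `G` (edges `E`): `roots(G') ⊇ leaves(G)` and for
every pmf factorizing over `G` there is a conditional system for `N ∖ leaves(G)` given
`leaves(G)` factorizing over `G'` which is a version of its conditional distribution. -/
def GoalI (E E' : V → V → Prop) [DecidableRel E] : Prop :=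
  (∀ s ∈ leavesF E, ∀ t, ¬ E' t s) ∧
  ∀ p : (∀ v, X v) → ℝ, IsPMF X p → Factorizes X E p →
    ∃ q, IsCondSystem X (leavesF E) q ∧ CondFactorizes X E' (leavesF E) q ∧
      IsVersionOf X (leavesF E) q p

/-- `G'` (edges `E'`) satisfies Goal II for `G` (edges `E`): `P^{G'} ⊇ P^G` and every parent
in `G'` of a leaf of `G` is itself a leaf of `G`. -/
def GoalII (E E' : V → V → Prop) : Prop :=
  (∀ p : (∀ v, X v) → ℝ, IsPMF X p → Factorizes X E p → Factorizes X E' p) ∧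
  ∀ s t, (∀ u, ¬ E s u) → E' t s → ∀ u, ¬ E t u

end Prob

/-- A directed graph whose edges increase some function to an ordered set is a DAG. -/
theorem isDAG_of_forall_lt {V ι : Type*} [Preorder ι] {E : V → V → Prop} (O : V → ι)
    (h : ∀ s t, E s t → O s < O t) : IsDAG E := by
  have hlt {s t : V} (hst : Relation.TransGen E s t) : O s < O t := by
    induction hst with
    | single hst => exact h _ _ hst
    | tail _ htu ih => exact ih.trans (h _ _ htu)
  exact fun s hs => lt_irrefl _ (hlt hs)

/-- A kernel with respect to a graph is a kernel with respect to any graph giving the node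
more parents. -/
theorem IsKernel.mono {V : Type*} {X : V → Type*} [∀ v, Fintype (X v)] {E F : V → V → Prop}
    {s : V} {k : X s → (∀ v, X v) → ℝ} (hk : IsKernel X E s k)
    (hEF : ∀ t, E t s → F t s) : IsKernel X F s k :=
  ⟨hk.1, fun a x y h => hk.2.1 a x y fun t ht => h t (hEF t ht), hk.2.2⟩

section Kernels

variable {V : Type*} [Fintype V] [DecidableEq V]
variable {X : V → Type*} [∀ v, Fintype (X v)]
variable [∀ v, DecidableEq (X v)]

theorem marg_nonneg {p : (∀ v, X v) → ℝ} (hp : ∀ x, 0 ≤ p x) (C : Finset V) (x : ∀ v, X v) :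
    0 ≤ marg X p C x :=
  Finset.sum_nonneg fun y _ => by split_ifs <;> simp [hp y]

/-- The marginal on `C` depends only on the coordinates in `C`. -/
theorem marg_congr (p : (∀ v, X v) → ℝ) {C : Finset V} {x y : ∀ v, X v}
    (h : ∀ v ∈ C, x v = y v) : marg X p C x = marg X p C y := by
  unfold marg
  refine Finset.sum_congr rfl fun z _ => if_congr ?_ rfl rfl
  exact forall₂_congr fun v hv => by rw [h v hv]

/-- Summing the marginal on `insert a C` over the coordinate `a` gives the marginal on `C`. -/
theorem sum_marg_insert (p : (∀ v, X v) → ℝ) {a : V} {C : Finset V} (ha : a ∉ C)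
    (x : ∀ v, X v) :
    ∑ b, marg X p (insert a C) (Function.update x a b) = marg X p C x := by
  unfold marg
  rw [Finset.sum_comm]
  refine Finset.sum_congr rfl fun y _ => ?_
  have key (b : X a) : (∀ v ∈ insert a C, y v = Function.update x a b v) ↔
      y a = b ∧ ∀ v ∈ C, y v = x v := by
    rw [Finset.forall_mem_insert, Function.update_self]
    refine and_congr_right fun _ => forall₂_congr fun v hv => ?_
    rw [Function.update_of_ne (ne_of_mem_of_not_mem hv ha)]
  simp only [key, ite_and, Finset.sum_ite_eq, Finset.mem_univ, if_true]

variable [∀ v, Nonempty (X v)]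

/-- The conditional distribution of the coordinate `a` given the coordinates in `C`. -/
theorem exists_kernel_marg_insert {p : (∀ v, X v) → ℝ} (hp : ∀ x, 0 ≤ p x) {a : V}
    {C : Finset V} (ha : a ∉ C) :
    ∃ κ : X a → (∀ v, X v) → ℝ, IsKernel X (fun t _ => t ∈ C) a κ ∧
      ∀ x, marg X p (insert a C) x = marg X p C x * κ (x a) x := by
  refine ⟨fun b x => if marg X p C x = 0 then (Fintype.card (X a) : ℝ)⁻¹ else
    marg X p (insert a C) (Function.update x a b) / marg X p C x, ⟨?_, ?_, ?_⟩, ?_⟩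
  · intro b x
    dsimp only
    split_ifs
    · positivity
    · exact div_nonneg (marg_nonneg hp _ _) (marg_nonneg hp _ _)
  · intro b x y h
    have h' : marg X p (insert a C) (Function.update x a b) =
        marg X p (insert a C) (Function.update y a b) := by
      refine marg_congr p fun v hv => ?_
      by_cases hva : v = a
      · subst hva
        simp
      · simpa [hva] using h v (Finset.mem_of_mem_insert_of_ne hv hva)
    simp only [marg_congr p h, h']
  · intro x
    by_cases h : marg X p C x = 0
    · simp [h]
    · simp only [h, if_false]
      rw [← Finset.sum_div, sum_marg_insert p ha, div_self h]
  · intro x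
    by_cases h : marg X p C x = 0
    · have hle := Finset.single_le_sum
        (f := fun b => marg X p (insert a C) (Function.update x a b))
        (fun b _ => marg_nonneg hp _ _) (Finset.mem_univ (x a))
      rw [sum_marg_insert p ha, h, Function.update_eq_self] at hle
      rw [h, zero_mul]
      exact le_antisymm hle (marg_nonneg hp _ _)
    · simp only [h, if_false, Function.update_eq_self]
      field_simp

/-- Chain rule: the marginal on `C` is a product of kernels, each depending only on the
coordinates in `C` that precede the node in a given ordering. -/
theorem exists_kernels_marg {p : (∀ v, X v) → ℝ} (hp : IsPMF X p) {ι : Type*} [LinearOrder ι]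
    {O : V → ι} (hO : Function.Injective O) (C : Finset V) :
    ∃ k : ∀ s, X s → (∀ v, X v) → ℝ,
      (∀ s ∈ C, IsKernel X (fun t s => t ∈ C ∧ O t < O s) s (k s)) ∧
        ∀ x, marg X p C x = ∏ s ∈ C, k s (x s) x := by
  induction C using Finset.induction_on_max_value O with
  | empty => exact ⟨fun _ _ _ => 0, by simp, fun x => by simpa [marg] using hp.2⟩
  | insert a C ha hmax ih =>
    obtain ⟨k, hk, hprod⟩ := ih
    obtain ⟨κ, hκ, hκp⟩ := exists_kernel_marg_insert hp.1 ha
    refine ⟨Function.update k a κ, fun s hs => ?_, fun x => ?_⟩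
    · by_cases hsa : s = a
      · subst hsa
        rw [Function.update_self]
        exact hκ.mono fun t ht => ⟨Finset.mem_insert_of_mem ht,
          lt_of_le_of_ne (hmax t ht) (hO.ne (ne_of_mem_of_not_mem ht ha))⟩
      · rw [Function.update_of_ne hsa]
        exact (hk s (Finset.mem_of_mem_insert_of_ne hs hsa)).mono fun t ht =>
          ⟨Finset.mem_insert_of_mem ht.1, ht.2⟩
    · rw [Finset.prod_insert ha, Function.update_self, hκp, hprod, mul_comm]
      congr 1
      exact Finset.prod_congr rfl fun s hs => by
        rw [Function.update_of_ne (ne_of_mem_of_not_mem hs ha)]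

end Kernels

/-- if `G'` satisfies Goal I for `G` and `O'` is a topological ordering of
`G'`, then `G̃' = (N, E' ∪ E_leaves)` (joining the leaves of `G` along `O'`) is a DAG
satisfying Goal II for `G`. -/
theorem stmt2 {V : Type*} [Fintype V] [DecidableEq V] [Nonempty V]
    (X : V → Type*) [∀ v, Fintype (X v)] [∀ v, Nonempty (X v)] [∀ v, DecidableEq (X v)]
    (E E' : V → V → Prop) [DecidableRel E] (hE : IsDAG E) (hE' : IsDAG E')
    (O' : V → Fin (Fintype.card V)) (hO' : IsTopo E' O')
    (hGoal : GoalI X E E') :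
    IsDAG (fun s t => E' s t ∨ ((∀ u, ¬ E s u) ∧ (∀ u, ¬ E t u) ∧ O' s < O' t)) ∧
    GoalII X E (fun s t => E' s t ∨ ((∀ u, ¬ E s u) ∧ (∀ u, ¬ E t u) ∧ O' s < O' t)) := by
  have mem_leaves (s : V) : s ∈ leavesF E ↔ ∀ u, ¬ E s u := by simp [leavesF]
  refine ⟨isDAG_of_forall_lt O' fun s t h => h.elim (hO'.2 s t) fun h => h.2.2,
    fun p hp hpE => ?_, ?_⟩
  · obtain ⟨q, -, ⟨k, hk, hq⟩, hver⟩ := hGoal.2 p hp hpE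
    obtain ⟨l, hl, hmarg⟩ := exists_kernels_marg hp hO'.1 (leavesF E)
    refine ⟨fun s => if s ∈ leavesF E then l s else k s, fun s => ?_, fun x => ?_⟩
    · dsimp only
      split_ifs with hs
      · exact (hl s hs).mono fun t ht =>
          Or.inr ⟨(mem_leaves t).1 ht.1, (mem_leaves s).1 hs, ht.2⟩
      · exact (hk s hs).mono fun t ht => Or.inl ht
    · rw [hver, hq, hmarg, ← Finset.prod_sdiff (Finset.subset_univ (leavesF E))]
      congr 1
      · exact Finset.prod_congr rfl fun s hs => by simp only [if_neg (Finset.mem_sdiff.1 hs).2]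
      · exact Finset.prod_congr rfl fun s hs => by simp only [if_pos hs]
  · rintro s t hs (h | h)
    · exact absurd h (hGoal.1 s ((mem_leaves s).2 hs) t)
    · exact h.1
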